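/- Suppose 1/2 ≤ ε < 1 and P is an ε-corner chop of the standard triangle Δ = conv{(0,0),(1,0),(0,1)} at some vertex. Then no vertex of P has both of its incident edges of rational length strictly greater than ε. Consequently, there is no sequence of two successive ε-corner chops starting from Δ. -/

import Mathlib

open MeasureTheory

noncomputable section

/-- The real vector in `ℝ²` corresponding to an integer vector in `ℤ²`. -/
def intVec (u : ℤ × ℤ) : ℝ × ℝ := ((u.1 : ℝ), (u.2 : ℝ))

/-- `RatLenIs w ℓ` : the vector `w` lies on a line of rational slope and has rational
length `ℓ`, i.e. `ℓ > 0` and `w / ℓ` is a primitive vector of `ℤ²` (coprime coordinates). -/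
def RatLenIs (w : ℝ × ℝ) (ℓ : ℝ) : Prop :=
  0 < ℓ ∧ ∃ u : ℤ × ℤ, IsCoprime u.1 u.2 ∧ w = ℓ • intVec u

/-- The closed segment `[a, b]`, with `a ≠ b`, is an edge (a one-dimensional face,
i.e. an extreme subset which is a nondegenerate segment) of the convex set `P`. -/
def IsEdge (P : Set (ℝ × ℝ)) (a b : ℝ × ℝ) : Prop :=
  a ≠ b ∧ IsExtreme ℝ P (segment ℝ a b)

/-- `u ∈ ℤ²` is a direction of an edge of `P` emanating from the vertex `v`. -/
def EdgeDir (P : Set (ℝ × ℝ)) (v : ℝ × ℝ) (u : ℤ × ℤ) : Prop :=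
  ∃ w, IsEdge P v w ∧ ∃ ℓ : ℝ, 0 < ℓ ∧ w - v = ℓ • intVec u

/-- The Delzant condition at the vertex `v` of `P`, witnessed by `u₁, u₂` : these are the
primitive integer vectors pointing from `v` along the two edges of `P` incident to `v`,
and they form a `ℤ`-basis of `ℤ²` (their determinant is `±1`). -/
def DelzantAt (P : Set (ℝ × ℝ)) (v : ℝ × ℝ) (u₁ u₂ : ℤ × ℤ) : Prop :=
  IsCoprime u₁.1 u₁.2 ∧ IsCoprime u₂.1 u₂.2 ∧
  EdgeDir P v u₁ ∧ EdgeDir P v u₂ ∧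
  (u₁.1 * u₂.2 - u₁.2 * u₂.1 = 1 ∨ u₁.1 * u₂.2 - u₁.2 * u₂.1 = -1) ∧
  ∀ u : ℤ × ℤ, IsCoprime u.1 u.2 → EdgeDir P v u → u = u₁ ∨ u = u₂

/-- `V` is the (finite) vertex set of a Delzant polygon `P = conv V ⊆ ℝ²`: `P` is a compact
convex polygon with nonempty interior, its set of vertices (extreme points) is exactly `V`,
and at each vertex the primitive directions of the two incident edges form a `ℤ`-basis of
`ℤ²`; in particular every edge has rational slope. -/
def IsDelzantPolygon (V : Set (ℝ × ℝ)) : Prop :=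
  V.Finite ∧ (interior (convexHull ℝ V)).Nonempty ∧
  Set.extremePoints ℝ (convexHull ℝ V) = V ∧
  ∀ v ∈ V, ∃ u₁ u₂ : ℤ × ℤ, DelzantAt (convexHull ℝ V) v u₁ u₂

/-- The new vertex set `(V ∖ {v}) ∪ {v + ε·u₁, v + ε·u₂}` of the `ε`-corner chop at `v`
of the polygon with vertex set `V`. -/
def chopSet (V : Set (ℝ × ℝ)) (v : ℝ × ℝ) (u₁ u₂ : ℤ × ℤ) (ε : ℝ) : Set (ℝ × ℝ) :=
  (V \ {v}) ∪ {v + ε • intVec u₁, v + ε • intVec u₂}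

/-- The polygon with vertex set `W` is an `ε`-corner chop of the Delzant polygon with
vertex set `V` at some vertex `v` whose two incident edges both have rational length
strictly greater than `ε`. -/
def IsCornerChop (V W : Set (ℝ × ℝ)) (ε : ℝ) : Prop :=
  0 < ε ∧ ∃ v ∈ V, ∃ u₁ u₂ : ℤ × ℤ,
    DelzantAt (convexHull ℝ V) v u₁ u₂ ∧
    (∀ w ℓ, IsEdge (convexHull ℝ V) v w → RatLenIs (w - v) ℓ → ε < ℓ) ∧
    convexHull ℝ W = convexHull ℝ (chopSet V v u₁ u₂ ε)

/-- The vertex set of the standard triangle `Δ = conv {(0,0), (1,0), (0,1)}`. -/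
def stdTri : Set (ℝ × ℝ) := {(0, 0), (1, 0), (0, 1)}

theorem intVec_eq_of_smul_intVec_eq {u p : ℤ × ℤ} {ℓ : ℝ} (hℓ : 0 < ℓ)
    (hu : IsCoprime u.1 u.2) (hp : IsCoprime p.1 p.2) (h : ℓ • intVec u = intVec p) : u = p := by
  obtain ⟨h₁, h₂⟩ : ℓ * u.1 = p.1 ∧ ℓ * u.2 = p.2 := by
    simpa [intVec, Prod.ext_iff] using h
  obtain ⟨a, b, hab⟩ := hu
  obtain ⟨c, d, hcd⟩ := hp
  have hn : ℓ = ((a * p.1 + b * p.2 : ℤ) : ℝ) := by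
    have : (a * u.1 + b * u.2 : ℝ) = 1 := by exact_mod_cast hab
    push_cast
    rw [← h₁, ← h₂]
    linear_combination (-ℓ) * this
  have hm : ℓ * ((c * u.1 + d * u.2 : ℤ) : ℝ) = 1 := by
    have : (c * p.1 + d * p.2 : ℝ) = 1 := by exact_mod_cast hcd
    push_cast
    rw [← h₁, ← h₂] at this
    linear_combination this
  generalize a * p.1 + b * p.2 = n at hn
  generalize c * u.1 + d * u.2 = m at hm
  subst hn
  have hn0 : 0 < n := by exact_mod_cast hℓ
  have hnm : n * m = 1 := by exact_mod_cast hm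
  have hn1 : n = 1 := Int.eq_one_of_mul_eq_one_right hn0.le hnm
  subst hn1
  simp only [Int.cast_one, one_mul, Int.cast_inj] at h₁ h₂
  exact Prod.ext h₁ h₂

theorem IsEdge.symm {P : Set (ℝ × ℝ)} {a b : ℝ × ℝ} (h : IsEdge P a b) : IsEdge P b a :=
  ⟨h.1.symm, segment_symm ℝ a b ▸ h.2⟩

theorem IsEdge.right_mem_extremePoints {P : Set (ℝ × ℝ)} {a b : ℝ × ℝ} (h : IsEdge P a b) :
    b ∈ P.extremePoints ℝ := by
  refine h.2.extremePoints_subset_extremePoints ?_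
  rw [mem_extremePoints]
  refine ⟨right_mem_segment ℝ a b, ?_⟩
  intro x hx y hy hb
  rw [segment_eq_image'] at hx hy
  obtain ⟨s, ⟨hs0, hs1⟩, rfl⟩ := hx
  obtain ⟨t, ⟨ht0, ht1⟩, rfl⟩ := hy
  obtain ⟨α, β, hα, hβ, hαβ, hb⟩ := hb
  have hz : (1 - (α * s + β * t)) • (b - a) = 0 := by
    have : a = (α + β) • a := by rw [hαβ, one_smul]
    have hb' : α • (a + s • (b - a)) + β • (a + t • (b - a))
        = (α + β) • a + (α * s + β * t) • (b - a) := by module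
    rw [hb', hαβ, one_smul] at hb
    rw [sub_smul, one_smul, sub_eq_zero, sub_eq_iff_eq_add']
    exact hb.symm
  have h1 : 1 - (α * s + β * t) = 0 :=
    (smul_eq_zero.mp hz).resolve_right (sub_ne_zero.mpr h.1.symm)
  have hs : s = 1 := by nlinarith
  have ht : t = 1 := by nlinarith
  subst hs ht
  simp

/-- The primitive edge directions at a vertex of a lattice triangle with primitive sides. -/
theorem EdgeDir.eq_or_eq_of_triangle {v : ℝ × ℝ} {p q u : ℤ × ℤ}
    (hp : IsCoprime p.1 p.2) (hq : IsCoprime q.1 q.2) (hu : IsCoprime u.1 u.2)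
    (h : EdgeDir (convexHull ℝ {v, v + intVec p, v + intVec q}) v u) : u = p ∨ u = q := by
  obtain ⟨w, hw, ℓ, hℓ, hwu⟩ := h
  rcases extremePoints_convexHull_subset hw.right_mem_extremePoints with rfl | rfl | rfl
  · exact absurd rfl hw.1
  · exact Or.inl (intVec_eq_of_smul_intVec_eq hℓ hu hp (by simpa using hwu.symm))
  · exact Or.inr (intVec_eq_of_smul_intVec_eq hℓ hu hq (by simpa using hwu.symm))

/-- The vertices of the `ε`-chop at `v` of the triangle with vertices `v`, `v + p`, `v + q`. -/
def choppedTriangle (v : ℝ × ℝ) (p q : ℤ × ℤ) (ε : ℝ) : Set (ℝ × ℝ) :=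
  {v + intVec p, v + intVec q, v + ε • intVec p, v + ε • intVec q}

theorem choppedTriangle_comm (v : ℝ × ℝ) (p q : ℤ × ℤ) (ε : ℝ) :
    choppedTriangle v p q ε = choppedTriangle v q p ε := by
  ext x
  simp only [choppedTriangle, Set.mem_insert_iff, Set.mem_singleton_iff]
  tauto

theorem isEdge_choppedTriangle {v : ℝ × ℝ} {p q : ℤ × ℤ} {ε : ℝ} (h0 : 0 < ε) (h1 : ε < 1)
    (hdet : (p.1 * q.2 - p.2 * q.1) ^ 2 = 1) :
    IsEdge (convexHull ℝ (choppedTriangle v p q ε)) (v + intVec p) (v + ε • intVec p) := by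
  have hd : ((p.1 * q.2 - p.2 * q.1 : ℝ)) ^ 2 = 1 := by exact_mod_cast hdet
  -- Coordinates in the basis `p, q` based at `v`.
  have key : ∀ x ∈ convexHull ℝ (choppedTriangle v p q ε), ∃ s t : ℝ,
      x = v + s • intVec p + t • intVec q ∧ 0 ≤ t ∧ ε ≤ s + t ∧ s + t ≤ 1 := by
    intro x hx
    let S : Set (ℝ × ℝ) := {x | ∃ s t : ℝ,
      x = v + s • intVec p + t • intVec q ∧ 0 ≤ t ∧ ε ≤ s + t ∧ s + t ≤ 1}
    refine convexHull_min (t := S) ?_ ?_ hx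
    · rintro x (rfl | rfl | rfl | rfl)
      · exact ⟨1, 0, by module, le_rfl, by linarith, by linarith⟩
      · exact ⟨0, 1, by module, by norm_num, by linarith, by linarith⟩
      · exact ⟨ε, 0, by module, le_rfl, by linarith, by linarith⟩
      · exact ⟨0, ε, by module, h0.le, by linarith, by linarith⟩
    · rintro _ ⟨s, t, rfl, ht, hl, hr⟩ _ ⟨s', t', rfl, ht', hl', hr'⟩ a b ha hb hab
      refine ⟨a * s + b * s', a * t + b * t', ?_, by positivity, by nlinarith, by nlinarith⟩
      obtain rfl : b = 1 - a := by linarith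
      module
  refine ⟨?_, ?_, ?_⟩
  · intro h
    have hz : (1 - ε) • intVec p = 0 := by
      have := add_left_cancel h
      rw [sub_smul, one_smul, ← this, sub_self]
    have hp : intVec p = 0 := (smul_eq_zero.mp hz).resolve_left (by linarith)
    obtain ⟨e₁, e₂⟩ : (p.1 : ℝ) = 0 ∧ (p.2 : ℝ) = 0 := by
      simpa [intVec, Prod.ext_iff] using hp
    simp [e₁, e₂] at hd
  · exact segment_subset_convexHull (by simp [choppedTriangle]) (by simp [choppedTriangle])
  · intro x hx y hy z hz hxyz
    obtain ⟨s, t, rfl, ht, hl, hr⟩ := key x hx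
    obtain ⟨s', t', rfl, ht', hl', hr'⟩ := key y hy
    rw [segment_eq_image'] at hz
    obtain ⟨r, hr, rfl⟩ := hz
    obtain ⟨α, β, hα, hβ, hαβ, hc⟩ := hxyz
    obtain rfl : β = 1 - α := by linarith
    have e₁ := congrArg Prod.fst hc
    have e₂ := congrArg Prod.snd hc
    simp only [intVec, Prod.fst_add, Prod.snd_add, Prod.smul_fst, Prod.smul_snd, Prod.fst_sub,
      Prod.snd_sub, smul_eq_mul] at e₁ e₂
    have hsum : α * t + (1 - α) * t' = 0 := by
      linear_combination (p.1 * q.2 - p.2 * q.1 : ℝ) * (p.1 * e₂ - p.2 * e₁)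
        - (α * t + (1 - α) * t') * hd
    have ht0 : t = 0 := by
      have h₁ : 0 ≤ α * t := by positivity
      have h₂ : 0 ≤ (1 - α) * t' := by positivity
      have : α * t = 0 := by linarith
      exact (mul_eq_zero.mp this).resolve_left hα.ne'
    subst ht0
    rw [segment_eq_image']
    have hε : 1 - ε ≠ 0 := by linarith
    refine ⟨(1 - s) / (1 - ε), ⟨div_nonneg (by linarith) (by linarith),
      (div_le_one (by linarith)).mpr (by linarith)⟩, ?_⟩
    have hs : (1 - s) / (1 - ε) * (1 - ε) = 1 - s := div_mul_cancel₀ _ hε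
    have : ∀ k : ℝ, v + intVec p + k • (v + ε • intVec p - (v + intVec p))
        = v + (1 - k * (1 - ε)) • intVec p := fun k => by module
    simp only [this, hs]
    module

/-- Every vertex of the chopped triangle lies on an edge of rational length `1 - ε`. -/
theorem exists_isEdge_choppedTriangle {v x : ℝ × ℝ} {p q : ℤ × ℤ} {ε : ℝ} (h0 : 0 < ε)
    (h1 : ε < 1) (hdet : (p.1 * q.2 - p.2 * q.1) ^ 2 = 1)
    (hp : IsCoprime p.1 p.2) (hq : IsCoprime q.1 q.2) (hx : x ∈ choppedTriangle v p q ε) :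
    ∃ w, IsEdge (convexHull ℝ (choppedTriangle v p q ε)) x w ∧ RatLenIs (w - x) (1 - ε) := by
  have hneg : ∀ u : ℤ × ℤ, intVec (-u) = -intVec u := fun u => by simp [intVec]
  have hdet' : (q.1 * p.2 - q.2 * p.1) ^ 2 = 1 := by linear_combination hdet
  have hep := isEdge_choppedTriangle (v := v) h0 h1 hdet
  have heq := isEdge_choppedTriangle (v := v) h0 h1 hdet'
  rw [choppedTriangle_comm] at heq
  have hε : 0 < 1 - ε := by linarith
  rcases hx with rfl | rfl | rfl | rfl
  · exact ⟨_, hep, hε, -p, by simpa using hp.neg_neg, by rw [hneg]; module⟩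
  · exact ⟨_, heq, hε, -q, by simpa using hq.neg_neg, by rw [hneg]; module⟩
  · exact ⟨_, hep.symm, hε, p, hp, by module⟩
  · exact ⟨_, heq.symm, hε, q, hq, by module⟩

theorem chopSet_triangle {v : ℝ × ℝ} {p q u₁ u₂ : ℤ × ℤ} {ε : ℝ}
    (hp : IsCoprime p.1 p.2) (hq : IsCoprime q.1 q.2)
    (h : DelzantAt (convexHull ℝ {v, v + intVec p, v + intVec q}) v u₁ u₂) :
    chopSet {v, v + intVec p, v + intVec q} v u₁ u₂ ε = choppedTriangle v p q ε := by
  obtain ⟨hc₁, hc₂, hd₁, hd₂, hdet, -⟩ := h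
  have hne : u₁ ≠ u₂ := by
    rintro rfl
    rcases hdet with h | h <;> rw [mul_comm, sub_self] at h <;> omega
  have hnz : ∀ u : ℤ × ℤ, IsCoprime u.1 u.2 → intVec u ≠ 0 := by
    intro u hu h
    obtain ⟨e₁, e₂⟩ : u.1 = 0 ∧ u.2 = 0 := by
      simpa [intVec, Prod.ext_iff] using h
    rw [e₁, e₂] at hu
    exact not_isCoprime_zero_zero hu
  have hdiff : ({v, v + intVec p, v + intVec q} \ {v} : Set (ℝ × ℝ))
      = {v + intVec p, v + intVec q} := by
    apply Set.insert_sdiff_self_of_notMem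
    simp [hnz p hp, hnz q hq]
  rw [chopSet, hdiff]
  rcases hd₁.eq_or_eq_of_triangle hp hq hc₁ with rfl | rfl <;>
    rcases hd₂.eq_or_eq_of_triangle hp hq hc₂ with rfl | rfl
  · exact absurd rfl hne
  · ext x
    simp only [choppedTriangle, Set.mem_union, Set.mem_insert_iff, Set.mem_singleton_iff]
    tauto
  · ext x
    simp only [choppedTriangle, Set.mem_union, Set.mem_insert_iff, Set.mem_singleton_iff]
    tauto
  · exact absurd rfl hne

/-- The standard triangle, seen from any of its vertices. -/
theorem exists_stdTri_eq {v : ℝ × ℝ} (hv : v ∈ stdTri) : ∃ p q : ℤ × ℤ,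
    IsCoprime p.1 p.2 ∧ IsCoprime q.1 q.2 ∧ (p.1 * q.2 - p.2 * q.1) ^ 2 = 1 ∧
    stdTri = {v, v + intVec p, v + intVec q} := by
  rcases hv with rfl | rfl | rfl
  · exact ⟨(1, 0), (0, 1), by simp [Int.isCoprime_iff_gcd_eq_one],
      by simp [Int.isCoprime_iff_gcd_eq_one], by simp, by simp [stdTri, intVec]⟩
  · refine ⟨(-1, 0), (-1, 1), by simp [Int.isCoprime_iff_gcd_eq_one],
      by simp [Int.isCoprime_iff_gcd_eq_one], by simp, ?_⟩
    simp [stdTri, intVec, Set.insert_comm]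
  · refine ⟨(0, -1), (1, -1), by simp [Int.isCoprime_iff_gcd_eq_one],
      by simp [Int.isCoprime_iff_gcd_eq_one], by simp, ?_⟩
    ext x
    simp only [stdTri, intVec, Set.mem_insert_iff, Set.mem_singleton_iff, Prod.mk_add_mk]
    norm_num
    tauto

/-- for `1/2 ≤ ε < 1`, after one `ε`-corner chop of the standard triangle
`Δ`, no vertex of the resulting polygon has both incident edges of rational length
strictly greater than `ε`; consequently there is no sequence of two successive
`ε`-corner chops starting from `Δ`. -/
theorem stdTri_no_second_chop (ε : ℝ) (h0 : 1 / 2 ≤ ε) (h1 : ε < 1)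
    (W : Set (ℝ × ℝ)) (hW : IsDelzantPolygon W) (hchop : IsCornerChop stdTri W ε) :
    (¬ ∃ v ∈ W, ∀ w ℓ, IsEdge (convexHull ℝ W) v w → RatLenIs (w - v) ℓ → ε < ℓ) ∧
    ¬ ∃ W₂ : Set (ℝ × ℝ), IsDelzantPolygon W₂ ∧ IsCornerChop W W₂ ε := by
  have hfirst : ¬ ∃ v ∈ W, ∀ w ℓ, IsEdge (convexHull ℝ W) v w → RatLenIs (w - v) ℓ → ε < ℓ := by
    rintro ⟨x, hx, hlen⟩
    obtain ⟨hε, v, hv, u₁, u₂, hD, -, hhull⟩ := hchop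
    obtain ⟨p, q, hp, hq, hdet, htri⟩ := exists_stdTri_eq hv
    rw [htri] at hD hhull
    rw [chopSet_triangle hp hq hD] at hhull
    have hxQ : x ∈ choppedTriangle v p q ε := by
      rw [← hW.2.2.1, hhull] at hx
      exact extremePoints_convexHull_subset hx
    obtain ⟨w, hw, hl⟩ := exists_isEdge_choppedTriangle hε h1 hdet hp hq hxQ
    have := hlen w (1 - ε) (hhull ▸ hw) hl
    linarith
  refine ⟨hfirst, ?_⟩
  rintro ⟨W₂, -, -, v, hv, _, _, -, hlen, -⟩
  exact hfirst ⟨v, hv, hlen⟩
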